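/- Let G be a simple connected graph on n vertices. Then its Von Neumann entropy satisfies H(G) > H(R_{2,n}) - log(4√2/3), where R_{2,n} is the cycle on n vertices. -/

import Mathlib

open Real BigOperators Finset Matrix SimpleGraph

noncomputable def nLap {V : Type*} [Fintype V] [DecidableEq V]
    (G : SimpleGraph V) [DecidableRel G.Adj] : Matrix V V ℝ :=
  Matrix.diagonal (fun v => 1 / Real.sqrt (G.degree v : ℝ)) *
    (Matrix.diagonal (fun v => (G.degree v : ℝ)) - G.adjMatrix ℝ) *
    Matrix.diagonal (fun v => 1 / Real.sqrt (G.degree v : ℝ))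

/-- The eigenvalues of a real symmetric matrix have the same sum of squares as its entries. -/
lemma Matrix.IsHermitian.sum_sq_eigenvalues {ι : Type*} [Fintype ι] [DecidableEq ι]
    {A : Matrix ι ι ℝ} (hA : A.IsHermitian) :
    ∑ i, hA.eigenvalues i ^ 2 = ∑ i, ∑ j, A i j ^ 2 := by
  have h : (A * A).trace = ∑ i, hA.eigenvalues i ^ 2 := by
    conv_lhs => rw [hA.spectral_theorem]
    rw [← map_mul, Unitary.conjStarAlgAut_apply, Matrix.trace_mul_cycle]
    simp [Matrix.trace, pow_two]
  rw [← h]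
  simp only [Matrix.trace, Matrix.diag, Matrix.mul_apply]
  refine Finset.sum_congr rfl fun i _ => Finset.sum_congr rfl fun j _ => ?_
  have := hA.apply i j
  rw [star_trivial] at this
  rw [this, pow_two]

section Entropy

/-- The Shannon entropy is bounded below by the Rényi entropy of order two. -/
lemma sum_mul_log_le_log_of_sum_sq_le {ι : Type*} [Fintype ι] {p : ι → ℝ} {s : ℝ}
    (hp : ∀ i, 0 ≤ p i) (h₁ : ∑ i, p i = 1) (hs : 0 < s) (h₂ : ∑ i, p i ^ 2 ≤ s) :
    ∑ i, p i * Real.log (p i) ≤ Real.log s := by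
  have key : ∀ i, p i * Real.log (p i) ≤ p i * (Real.log s - 1) + p i ^ 2 / s := by
    intro i
    rcases (hp i).eq_or_lt with h | h
    · simp [← h]
    · have h3 := Real.log_le_sub_one_of_pos (div_pos h hs)
      rw [Real.log_div h.ne' hs.ne'] at h3
      have h4 := mul_le_mul_of_nonneg_left h3 h.le
      have h5 : p i * (p i / s - 1) = p i ^ 2 / s - p i := by ring
      linarith
  have h6 := Finset.sum_le_sum fun i (_ : i ∈ Finset.univ) => key i
  rw [Finset.sum_add_distrib, ← Finset.sum_mul, h₁, ← Finset.sum_div] at h6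
  have h7 : (∑ i, p i ^ 2) / s ≤ 1 := (div_le_one hs).2 h₂
  linarith

lemma sub_one_add_sq_div_six_le_mul_log {x : ℝ} (h₀ : 0 ≤ x) (h₂ : x ≤ 2) :
    x - 1 + (x - 1) ^ 2 / 6 ≤ x * Real.log x := by
  rcases h₀.eq_or_lt with h | h
  · norm_num [← h]
  · obtain ⟨s, hs, rfl⟩ : ∃ s : ℝ, 0 < s ∧ x = s ^ 2 :=
      ⟨√x, Real.sqrt_pos.2 h, (Real.sq_sqrt h₀).symm⟩
    have h1 := Real.one_sub_inv_le_log_of_pos hs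
    have h2 := mul_le_mul_of_nonneg_left h1 (by positivity : 0 ≤ 2 * s ^ 2)
    have h3 : 2 * s ^ 2 * (1 - s⁻¹) = 2 * s ^ 2 - 2 * s := by field_simp
    have h4 : s ≤ 1.42 := by nlinarith
    have h5 : (s - 1) ^ 2 * (s + 1) ^ 2 ≤ (s - 1) ^ 2 * 6 :=
      mul_le_mul_of_nonneg_left (by nlinarith) (sq_nonneg _)
    rw [Real.log_pow]
    push_cast
    nlinarith

/-- A quantitative upper bound on the entropy of a distribution in terms of its second moment. -/
lemma le_sum_mul_log_of_sum_sq_eq {n : ℕ} (hn : 0 < n) {p : Fin n → ℝ}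
    (hp : ∀ i, 0 ≤ p i) (hp' : ∀ i, p i ≤ 2 / n) (h₁ : ∑ i, p i = 1)
    (h₂ : ∑ i, p i ^ 2 = 3 / (2 * n)) :
    1 / 12 - Real.log n ≤ ∑ i, p i * Real.log (p i) := by
  have hn' : (0 : ℝ) < n := by exact_mod_cast hn
  have key : ∀ i, n / 6 * p i ^ 2 + (2 / 3 - Real.log n) * p i - 5 / (6 * n)
      ≤ p i * Real.log (p i) := by
    intro i
    rcases (hp i).eq_or_lt with h | h
    · rw [← h]
      have : 0 < 5 / (6 * (n : ℝ)) := by positivity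
      simpa using this.le
    · have h3 : n * p i ≤ 2 := by
        have := (le_div_iff₀ hn').1 (hp' i)
        linarith
      have h4 := sub_one_add_sq_div_six_le_mul_log (by positivity) h3
      rw [Real.log_mul hn'.ne' h.ne'] at h4
      have h5 := div_le_div_of_nonneg_right h4 hn'.le
      have h6 : n * p i * (Real.log n + Real.log (p i)) / n
          = p i * Real.log n + p i * Real.log (p i) := by field_simp
      have h7 : (n * p i - 1 + (n * p i - 1) ^ 2 / 6) / n
          = n / 6 * p i ^ 2 + 2 / 3 * p i - 5 / (6 * n) := by field_simp; ring
      linarith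
  have h8 := Finset.sum_le_sum fun i (_ : i ∈ Finset.univ) => key i
  rw [Finset.sum_sub_distrib, Finset.sum_add_distrib, ← Finset.mul_sum, ← Finset.mul_sum, h₁, h₂,
    Finset.sum_const, Finset.card_univ, Fintype.card_fin, nsmul_eq_mul] at h8
  have h9 : n / 6 * (3 / (2 * n)) + (2 / 3 - Real.log n) * 1 - n * (5 / (6 * n))
      = 1 / 12 - Real.log n := by field_simp; ring
  linarith

end Entropy

section NormalizedLaplacian

variable {V : Type*} [Fintype V] [DecidableEq V] (G : SimpleGraph V) [DecidableRel G.Adj]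

lemma nLap_posSemidef : (nLap G).PosSemidef := by
  have h := (SimpleGraph.posSemidef_lapMatrix ℝ G).mul_mul_conjTranspose_same
    (Matrix.diagonal (fun v => 1 / Real.sqrt (G.degree v : ℝ)))
  rw [Matrix.diagonal_conjTranspose, star_trivial] at h
  exact h

lemma nLap_apply (u v : V) : nLap G u v =
    1 / √(G.degree u : ℝ) * ((if u = v then (G.degree u : ℝ) else 0) - if G.Adj u v then 1 else 0)
      * (1 / √(G.degree v : ℝ)) := by
  simp [nLap, Matrix.mul_diagonal, Matrix.diagonal_mul, Matrix.diagonal_apply,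
    SimpleGraph.adjMatrix_apply]

variable {G}

lemma nLap_apply_self {v : V} (hv : 0 < G.degree v) : nLap G v v = 1 := by
  have h : (0 : ℝ) < G.degree v := by exact_mod_cast hv
  rw [nLap_apply]
  simp only [if_true, SimpleGraph.irrefl, if_false, sub_zero]
  rw [mul_right_comm, div_mul_div_comm, Real.mul_self_sqrt h.le]
  field_simp

lemma nLap_apply_sq_of_ne {u v : V} (h : u ≠ v) :
    nLap G u v ^ 2 = if G.Adj u v then ((G.degree u : ℝ))⁻¹ * ((G.degree v : ℝ))⁻¹ else 0 := by
  rw [nLap_apply, if_neg h]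
  split_ifs
  · rw [mul_pow, mul_pow, div_pow, div_pow, Real.sq_sqrt (by positivity),
      Real.sq_sqrt (by positivity)]
    simp
  · simp

lemma sum_nLap_apply_sq {u : V} (hu : 0 < G.degree u) :
    ∑ v, nLap G u v ^ 2 =
      1 + ∑ v ∈ G.neighborFinset u, ((G.degree u : ℝ))⁻¹ * ((G.degree v : ℝ))⁻¹ := by
  have h : ∀ v, nLap G u v ^ 2 = (if u = v then 1 else 0) +
      if G.Adj u v then ((G.degree u : ℝ))⁻¹ * ((G.degree v : ℝ))⁻¹ else 0 := by
    intro v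
    by_cases h : u = v
    · subst h
      simp [nLap_apply_self hu]
    · rw [nLap_apply_sq_of_ne h, if_neg h, zero_add]
  simp_rw [h]
  rw [Finset.sum_add_distrib, Finset.sum_ite_eq, if_pos (Finset.mem_univ u),
    SimpleGraph.neighborFinset_eq_filter, Finset.sum_filter]

lemma sum_nLap_apply_sq_le_two (hG : ∀ v, 0 < G.degree v) (u : V) :
    ∑ v, nLap G u v ^ 2 ≤ 2 := by
  have hu : (0 : ℝ) < G.degree u := by exact_mod_cast hG u
  have h : ∑ v ∈ G.neighborFinset u, ((G.degree u : ℝ))⁻¹ * ((G.degree v : ℝ))⁻¹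
      ≤ ∑ v ∈ G.neighborFinset u, ((G.degree u : ℝ))⁻¹ := by
    refine Finset.sum_le_sum fun v _ => mul_le_of_le_one_right (by positivity) ?_
    exact inv_le_one_of_one_le₀ (by exact_mod_cast hG v)
  rw [Finset.sum_const, SimpleGraph.card_neighborFinset_eq_degree, nsmul_eq_mul,
    mul_inv_cancel₀ hu.ne'] at h
  rw [sum_nLap_apply_sq (hG u)]
  linarith

lemma sum_nLap_apply_sq_of_isRegularOfDegree_two (hG : G.IsRegularOfDegree 2) (u : V) :
    ∑ v, nLap G u v ^ 2 = 3 / 2 := by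
  rw [sum_nLap_apply_sq (by simp [hG.degree_eq])]
  simp [hG.degree_eq]
  norm_num

/-- The eigenvalues of the normalized Laplacian of a 2-regular graph are at most two. -/
lemma eigenvalues_smul_nLap_le (hG : G.IsRegularOfDegree 2) {c : ℝ} (hc : 0 ≤ c)
    (h : (c • nLap G).IsHermitian) (i : V) : h.eigenvalues i ≤ 2 * c := by
  have hev : Module.End.HasEigenvalue (Matrix.toLin' (c • nLap G)) (h.eigenvalues i) := by
    rw [Module.End.hasEigenvalue_iff_mem_spectrum, Matrix.spectrum_toLin']
    exact h.eigenvalues_mem_spectrum_real i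
  obtain ⟨u, hu⟩ := eigenvalue_mem_ball hev
  have hoff : ∀ v, v ∈ Finset.univ.erase u →
      ‖(c • nLap G) u v‖ = if G.Adj u v then c / 2 else 0 := by
    intro v hv
    have hne := (Finset.ne_of_mem_erase hv).symm
    have h2 : √(2 : ℝ) * √2 = 2 := Real.mul_self_sqrt (by norm_num)
    have h3 : (√(2 : ℝ))⁻¹ * (√2)⁻¹ = 1 / 2 := by rw [← mul_inv, h2]; norm_num
    rw [Matrix.smul_apply, nLap_apply, if_neg hne]
    split_ifs <;> simp [hG.degree_eq, abs_of_nonneg hc, h3, div_eq_mul_inv]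
  rw [Finset.sum_congr rfl hoff, Metric.mem_closedBall, Real.dist_eq, Matrix.smul_apply,
    nLap_apply_self (by simp [hG.degree_eq])] at hu
  have hle : ∑ v ∈ Finset.univ.erase u, (if G.Adj u v then c / 2 else 0)
      ≤ ∑ v, if G.Adj u v then c / 2 else 0 :=
    Finset.sum_le_sum_of_subset_of_nonneg (Finset.erase_subset _ _) fun v _ _ => by
      split_ifs <;> positivity
  have hsum : ∑ v, (if G.Adj u v then c / 2 else 0) = c := by
    rw [← Finset.sum_filter, ← SimpleGraph.neighborFinset_eq_filter, Finset.sum_const,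
      SimpleGraph.card_neighborFinset_eq_degree, hG.degree_eq, nsmul_eq_mul]
    push_cast
    ring
  have := (abs_le.1 hu).2
  simp only [smul_eq_mul, mul_one] at this
  linarith

lemma sum_eigenvalues_smul_nLap (hG : ∀ v, 0 < G.degree v) {c : ℝ}
    (h : (c • nLap G).IsHermitian) : ∑ i, h.eigenvalues i = c * Fintype.card V := by
  have ht := h.trace_eq_sum_eigenvalues
  simp only [RCLike.ofReal_real_eq_id, id] at ht
  rw [← ht]
  simp [Matrix.trace, nLap_apply_self (hG _), mul_comm]

lemma sum_sq_eigenvalues_smul_nLap {c : ℝ} (h : (c • nLap G).IsHermitian) :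
    ∑ i, h.eigenvalues i ^ 2 = c ^ 2 * ∑ u, ∑ v, nLap G u v ^ 2 := by
  simp [h.sum_sq_eigenvalues, mul_pow, Finset.mul_sum]

end NormalizedLaplacian

/-- For any connected graph G on n vertices, H(G) > H(R_{2,n}) - log(4√2/3),
where R_{2,n} is any 2-regular connected graph (cycle) on n vertices. -/
theorem stmt_16 (n : ℕ) (hn : 3 ≤ n) (G R : SimpleGraph (Fin n))
    [DecidableRel G.Adj] [DecidableRel R.Adj]
    (hG : G.Connected) (hR : R.Connected) (hreg : R.IsRegularOfDegree 2)
    (hρG : (((n : ℝ)⁻¹) • nLap G).IsHermitian)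
    (hρR : (((n : ℝ)⁻¹) • nLap R).IsHermitian) :
    -∑ i, hρG.eigenvalues i * Real.log (hρG.eigenvalues i) >
      (-∑ i, hρR.eigenvalues i * Real.log (hρR.eigenvalues i)) -
        Real.log (4 * Real.sqrt 2 / 3) := by
  have hn0 : (0 : ℝ) < n := by exact_mod_cast (by omega : 0 < n)
  have hnt : Nontrivial (Fin n) := Fin.nontrivial_iff_two_le.2 (by omega)
  have hdG : ∀ v, 0 < G.degree v := fun v => hG.preconnected.degree_pos_of_nontrivial v
  have hdR : ∀ v, 0 < R.degree v := fun v => by simp [hreg.degree_eq]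
  have hGupper : ∑ i, hρG.eigenvalues i * Real.log (hρG.eigenvalues i) ≤ Real.log (2 / n) := by
    refine sum_mul_log_le_log_of_sum_sq_le
      ((nLap_posSemidef G).smul (inv_nonneg.2 hn0.le)).eigenvalues_nonneg ?_ (by positivity) ?_
    · rw [sum_eigenvalues_smul_nLap hdG, Fintype.card_fin, inv_mul_cancel₀ hn0.ne']
    · have h := Finset.sum_le_sum fun u (_ : u ∈ Finset.univ) => sum_nLap_apply_sq_le_two hdG u
      rw [Finset.sum_const, Finset.card_univ, Fintype.card_fin, nsmul_eq_mul] at h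
      rw [sum_sq_eigenvalues_smul_nLap]
      refine (mul_le_mul_of_nonneg_left h (by positivity)).trans_eq ?_
      field_simp
  have hRlower : 1 / 12 - Real.log n
      ≤ ∑ i, hρR.eigenvalues i * Real.log (hρR.eigenvalues i) := by
    refine le_sum_mul_log_of_sum_sq_eq (by omega)
      ((nLap_posSemidef R).smul (inv_nonneg.2 hn0.le)).eigenvalues_nonneg
      (eigenvalues_smul_nLap_le hreg (inv_nonneg.2 hn0.le) hρR) ?_ ?_
    · rw [sum_eigenvalues_smul_nLap hdR, Fintype.card_fin, inv_mul_cancel₀ hn0.ne']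
    · rw [sum_sq_eigenvalues_smul_nLap]
      simp only [sum_nLap_apply_sq_of_isRegularOfDegree_two hreg, Finset.sum_const,
        Finset.card_univ, Fintype.card_fin, nsmul_eq_mul]
      field_simp
  have hlog : Real.log 2 - 1 / 16 ≤ Real.log (4 * √2 / 3) := by
    have h₁ : 2 * Real.log (4 * √2 / 3) = 2 * Real.log 2 - Real.log (9 / 8) := by
      have h₂ : (4 * √2 / 3) ^ 2 = 2 ^ 2 / (9 / 8) := by
        rw [div_pow, mul_pow, Real.sq_sqrt (by norm_num)]
        norm_num
      have h₃ := congrArg Real.log h₂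
      rw [Real.log_div (by norm_num) (by norm_num), Real.log_pow, Real.log_pow] at h₃
      exact_mod_cast h₃
    have h₄ := Real.log_le_sub_one_of_pos (by norm_num : (0 : ℝ) < 9 / 8)
    linarith
  rw [Real.log_div (by norm_num) hn0.ne'] at hGupper
  linarith
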